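/- arXiv:0705.3961 — 7 statements merged into one kernel-verified Lean document; each statement's English description precedes it below -/
import Mathlib

section
/- For all natural numbers p and q, setting n = p + q + 1, there exist real numbers r and s with r > 0, s > 0, r^2 + s^2 = 1, and (s/r)^2·(2p+1) + (r/s)^2·(2q+1) = 2(n+2). -/
/-- For positive `a` and `c` with `4 * (a * b) ≤ c ^ 2`, the equation `a * t + b / t = c` has a
positive solution. -/
lemma exists_pos_mul_add_div_eq {a b c : ℝ} (ha : 0 < a) (hc : 0 < c)
    (hdisc : 4 * (a * b) ≤ c ^ 2) : ∃ t : ℝ, 0 < t ∧ a * t + b / t = c := by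
  have hsq : √(c ^ 2 - 4 * (a * b)) ^ 2 = c ^ 2 - 4 * (a * b) :=
    Real.sq_sqrt (sub_nonneg.mpr hdisc)
  have hd : 0 ≤ √(c ^ 2 - 4 * (a * b)) := Real.sqrt_nonneg _
  generalize √(c ^ 2 - 4 * (a * b)) = d at hsq hd
  have hcd : 0 < c + d := by positivity
  refine ⟨(c + d) / (2 * a), by positivity, ?_⟩
  field_simp
  linarith

/-- Every positive real is the squared ratio of the coordinates of a point of the open first
quadrant of the unit circle. -/
lemma exists_unit_circle_div_sq_eq {t : ℝ} (ht : 0 < t) :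
    ∃ r s : ℝ, 0 < r ∧ 0 < s ∧ r ^ 2 + s ^ 2 = 1 ∧ (s / r) ^ 2 = t := by
  have h : 0 < 1 + t := by positivity
  have hr : √(1 / (1 + t)) ^ 2 = 1 / (1 + t) := Real.sq_sqrt (by positivity)
  have hs : √(t / (1 + t)) ^ 2 = t / (1 + t) := Real.sq_sqrt (by positivity)
  refine ⟨√(1 / (1 + t)), √(t / (1 + t)), by positivity, by positivity, ?_, ?_⟩
  · rw [hr, hs]
    field_simp
  · rw [div_pow, hr, hs]
    field_simp

/-- For all natural numbers `p` and `q`, setting `n = p + q + 1`, there exist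
positive reals `r`, `s` with `r^2 + s^2 = 1` satisfying the biharmonicity equation (E1):
`(s/r)^2 * (2p+1) + (r/s)^2 * (2q+1) = 2(n+2)`. -/
theorem biharmonic_generalized_clifford_exists (p q n : ℕ) (hn : n = p + q + 1) :
    ∃ r s : ℝ, 0 < r ∧ 0 < s ∧ r ^ 2 + s ^ 2 = 1 ∧
      (s / r) ^ 2 * (2 * (p : ℝ) + 1) + (r / s) ^ 2 * (2 * (q : ℝ) + 1) =
        2 * ((n : ℝ) + 2) := by
  obtain ⟨t, ht, heq⟩ := exists_pos_mul_add_div_eq (a := 2 * (p : ℝ) + 1)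
    (b := 2 * (q : ℝ) + 1) (c := 2 * ((n : ℝ) + 2)) (by positivity) (by positivity) (by
      subst hn
      push_cast
      nlinarith [sq_nonneg ((p : ℝ) - q), p.cast_nonneg (α := ℝ), q.cast_nonneg (α := ℝ)])
  obtain ⟨r, s, hr, hs, hrs, hratio⟩ := exists_unit_circle_div_sq_eq ht
  refine ⟨r, s, hr, hs, hrs, ?_⟩
  rw [← inv_div s r, inv_pow, hratio, ← heq]
  ring
end

section
/- Let p, q be natural numbers, n = p + q + 1, and let r, s be positive reals with r^2 + s^2 = 1 satisfying (s/r)^2·(2p+1) + (r/s)^2·(2q+1) = 2(n+2). Then (r^2, s^2) ≠ ((p+1)/(n+1), (q+1)/(n+1)). Equivalently, no solution of equation (E1) gives the radii of the minimal generalized Clifford torus. -/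
/-- No solution of the biharmonicity equation (E1) gives the radii of the
minimal generalized Clifford torus, i.e. `(r^2, s^2) ≠ ((p+1)/(n+1), (q+1)/(n+1))`. -/
theorem biharmonic_generalized_clifford_not_minimal (p q n : ℕ) (hn : n = p + q + 1)
    (r s : ℝ) (hr : 0 < r) (hs : 0 < s) (hrs : r ^ 2 + s ^ 2 = 1)
    (hE : (s / r) ^ 2 * (2 * (p : ℝ) + 1) + (r / s) ^ 2 * (2 * (q : ℝ) + 1) =
      2 * ((n : ℝ) + 2)) :
    (r ^ 2, s ^ 2) ≠ (((p : ℝ) + 1) / ((n : ℝ) + 1), ((q : ℝ) + 1) / ((n : ℝ) + 1)) := by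
  subst hn
  intro h
  obtain ⟨h₁, h₂⟩ := Prod.mk.inj h
  rw [div_pow, div_pow, h₁, h₂] at hE
  have ha : (0 : ℝ) < (p : ℝ) + 1 := by positivity
  have hb : (0 : ℝ) < (q : ℝ) + 1 := by positivity
  have hc : (0 : ℝ) < ((p + q + 1 : ℕ) : ℝ) + 1 := by positivity
  rw [div_div_div_cancel_right₀ hc.ne', div_div_div_cancel_right₀ hc.ne'] at hE
  push_cast at hE
  field_simp at hE
  have hsum : 0 < ((p : ℝ) + 1 + (q + 1)) ^ 2 := by positivity
  linarith
end

section
/- Let p, q be positive natural numbers with p + q = n + 1, and let r, s be distinct positive reals with p·r + q·s = 1. Set d = p/r + q/s and t = 2(n+1)^2 − d. If t·r^2 − 2(n+1)·r + 1 = 0 and t·s^2 − 2(n+1)·s + 1 = 0, then t satisfies t^2 − (2(n+1)^2 − (p−q)^2)·t + 4pq(n+1)^2 = 0. -/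
/-- If the two distinct values `r, s` (with multiplicities `p, q`,
`p + q = n + 1`, `p·r + q·s = 1`) both solve the quadratic `t·x^2 − 2(n+1)·x + 1 = 0`
with `t = 2(n+1)^2 − d`, `d = p/r + q/s`, then `t` satisfies
`t^2 − (2(n+1)^2 − (p−q)^2)·t + 4pq(n+1)^2 = 0`. -/
theorem clifford_torus_eliminant (p q n : ℕ) (hp : 0 < p) (hq : 0 < q)
    (hpq : p + q = n + 1) (r s : ℝ) (hr : 0 < r) (hs : 0 < s) (hrs : r ≠ s)
    (hsum : (p : ℝ) * r + (q : ℝ) * s = 1) (d t : ℝ)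
    (hd : d = (p : ℝ) / r + (q : ℝ) / s) (ht : t = 2 * ((n : ℝ) + 1) ^ 2 - d)
    (h1 : t * r ^ 2 - 2 * ((n : ℝ) + 1) * r + 1 = 0)
    (h2 : t * s ^ 2 - 2 * ((n : ℝ) + 1) * s + 1 = 0) :
    t ^ 2 - (2 * ((n : ℝ) + 1) ^ 2 - ((p : ℝ) - (q : ℝ)) ^ 2) * t +
      4 * (p : ℝ) * (q : ℝ) * ((n : ℝ) + 1) ^ 2 = 0 := by
  have hN : (n : ℝ) + 1 = p + q := by exact_mod_cast hpq.symm
  rw [hN] at h1 h2 ⊢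
  have hvieta : t * (r + s) = 2 * ((p : ℝ) + q) := by
    apply mul_left_cancel₀ (sub_ne_zero.mpr hrs)
    linear_combination h1 - h2
  obtain ⟨e, he⟩ : ∃ e, e = t * r - ((p : ℝ) + q) := ⟨_, rfl⟩
  have he_sq : e ^ 2 = ((p : ℝ) + q) ^ 2 - t := by
    rw [he]
    linear_combination t * h1
  have ht_lin : t - ((p : ℝ) + q) ^ 2 = (p - q) * e := by
    rw [he]
    linear_combination -t * hsum + q * hvieta
  linear_combination (t - ((p : ℝ) + q) ^ 2 + (p - q) * e) * ht_lin + ((p : ℝ) - q) ^ 2 * he_sq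
end

section
/- Let p, q be positive natural numbers with p + q = n + 1. Define a : Fin (n+1) → ℝ by a_i = 1/√(2p) for the first p indices and a_i = 1/√(2q) for the remaining q indices. Then a_i > 0 for all i, Σ_i a_i^2 = 1, and with d = Σ_j 1/a_j^2 (so d = 2p^2 + 2q^2), the equations a_i·d − 1/a_i^3 = 2(n+1)·((n+1)·a_i − 1/a_i) hold for every i. Moreover, if p ≠ q then there exists an index i with (n+1)·a_i − 1/a_i ≠ 0, so this solution is not minimal. -/
/-- A sum over `Fin m`, `m = p + q`, of a function with value `x` on the first `p` indices and
`y` on the remaining `q` indices. -/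
theorem sum_fin_ite_lt {p q m : ℕ} (h : p + q = m) (x y : ℝ) :
    ∑ i : Fin m, (if (i : ℕ) < p then x else y) = p * x + q * y := by
  subst h
  simp [Fin.sum_univ_add]

/-- The equation of (S2) for a radius `1 / √(2u)`, where `u` is one of the two block sizes. -/
theorem biharmonic_equation_one_div_sqrt {u v : ℝ} (hu : 0 < u) :
    1 / √(2 * u) * (2 * u ^ 2 + 2 * v ^ 2) - 1 / (1 / √(2 * u)) ^ 3 =
      2 * (u + v) * ((u + v) * (1 / √(2 * u)) - 1 / (1 / √(2 * u))) := by
  have hs : 0 < √(2 * u) := by positivity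
  have hsq : √(2 * u) ^ 2 = 2 * u := Real.sq_sqrt (by positivity)
  generalize √(2 * u) = s at hs hsq
  obtain rfl : u = s ^ 2 / 2 := by linarith
  field_simp
  ring

/-- For `p, q ≥ 1` with `p + q = n + 1`, the tuple taking the value
`1/√(2p)` on the first `p` indices and `1/√(2q)` on the remaining `q` indices is a
positive solution of the biharmonicity system (S2) with `Σ a_i^2 = 1` and
`d = 2p^2 + 2q^2`; if moreover `p ≠ q` it is not minimal, i.e. some
`(n+1)a_i − 1/a_i ≠ 0`. -/
theorem clifford_torus_explicit_solution (p q n : ℕ) (hp : 0 < p) (hq : 0 < q)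
    (hpq : p + q = n + 1) (a : Fin (n + 1) → ℝ)
    (ha : a = fun i : Fin (n + 1) => if (i : ℕ) < p then 1 / Real.sqrt (2 * (p : ℝ))
      else 1 / Real.sqrt (2 * (q : ℝ))) :
    (∀ i, 0 < a i) ∧
    (∑ i, (a i) ^ 2 = 1) ∧
    (∑ j, 1 / (a j) ^ 2 = 2 * (p : ℝ) ^ 2 + 2 * (q : ℝ) ^ 2) ∧
    (∀ i, a i * (∑ j, 1 / (a j) ^ 2) - 1 / (a i) ^ 3 =
      2 * ((n : ℝ) + 1) * (((n : ℝ) + 1) * a i - 1 / a i)) ∧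
    (p ≠ q → ∃ i, ((n : ℝ) + 1) * a i - 1 / a i ≠ 0) := by
  have hp' : (0 : ℝ) < p := by exact_mod_cast hp
  have hq' : (0 : ℝ) < q := by exact_mod_cast hq
  have hn : (n : ℝ) + 1 = p + q := by exact_mod_cast hpq.symm
  have hsp : √(2 * (p : ℝ)) ^ 2 = 2 * p := Real.sq_sqrt (by positivity)
  have hsq : √(2 * (q : ℝ)) ^ 2 = 2 * q := Real.sq_sqrt (by positivity)
  have hd : ∑ j, 1 / (a j) ^ 2 = 2 * (p : ℝ) ^ 2 + 2 * (q : ℝ) ^ 2 := by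
    have h : ∀ j, 1 / (a j) ^ 2 = if (j : ℕ) < p then 2 * (p : ℝ) else 2 * (q : ℝ) := by
      intro j
      simp only [ha]
      split_ifs <;> rw [div_pow, one_pow, one_div_one_div] <;> assumption
    rw [Finset.sum_congr rfl fun j _ => h j, sum_fin_ite_lt hpq]
    ring
  refine ⟨fun i => ?_, ?_, hd, fun i => ?_, fun hne => ⟨0, ?_⟩⟩
  · simp only [ha]
    split_ifs <;> positivity
  · have h : ∀ j, (a j) ^ 2 = if (j : ℕ) < p then 1 / (2 * (p : ℝ)) else 1 / (2 * (q : ℝ)) := by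
      intro j
      simp only [ha]
      split_ifs <;> rw [div_pow, one_pow] <;> simp only [hsp, hsq]
    rw [Finset.sum_congr rfl fun j _ => h j, sum_fin_ite_lt hpq]
    field_simp
    norm_num
  · rw [hd, hn]
    simp only [ha]
    split_ifs
    · exact biharmonic_equation_one_div_sqrt hp'
    · rw [add_comm (2 * (p : ℝ) ^ 2), add_comm (p : ℝ)]
      exact biharmonic_equation_one_div_sqrt hq'
  · have h0 : a 0 = 1 / √(2 * (p : ℝ)) := by simp [ha, hp]
    have hs : 0 < √(2 * (p : ℝ)) := by positivity
    rw [h0, hn, one_div_one_div]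
    generalize √(2 * (p : ℝ)) = s at hs hsp
    intro h
    field_simp at h
    exact hne (by exact_mod_cast (by linarith : (p : ℝ) = q))
end

section
/- Let n ≥ 1 and let b : Fin (n+1) → ℝ with b_i > 0 for all i and Σ_i b_i = 1. Suppose b takes exactly two distinct values r and s, with r attained at exactly p indices and s at exactly q indices (p, q ≥ 1), and suppose that with d = Σ_j 1/b_j every b_i satisfies (2(n+1)^2 − d)·b_i^2 − 2(n+1)·b_i + 1 = 0. Then p ≠ q and {r, s} = {1/(2p), 1/(2q)}. -/
/-- A function on a finite type taking only two distinct values has the sum of its values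
determined by the sizes of its two fibres. -/
theorem sum_comp_eq_of_two_valued {ι α M : Type*} [Fintype ι] [AddCommMonoid M]
    {b : ι → α} {r s : α} (hrs : r ≠ s) (hval : ∀ i, b i = r ∨ b i = s) (f : α → M) :
    ∑ i, f (b i) = {i | b i = r}.ncard • f r + {i | b i = s}.ncard • f s := by
  classical
  have hs : Finset.univ.filter (fun i => ¬ b i = r) = Finset.univ.filter (fun i => b i = s) := by
    ext i
    rcases hval i with h | h <;> simp [h, hrs, hrs.symm]
  have hconst (x : α) : ∑ i with b i = x, f (b i) = {i | b i = x}.ncard • f x := by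
    rw [Finset.sum_congr rfl fun i hi => congrArg f (Finset.mem_filter.1 hi).2,
      Finset.sum_const, Set.ncard_eq_toFinset_card', Set.toFinset_ofPred]
  rw [← Finset.sum_filter_add_sum_filter_not Finset.univ (fun i => b i = r), hs, hconst, hconst]

/-- Vieta's formula for the sum of the reciprocals of two distinct roots, with denominators
cleared. -/
theorem add_eq_mul_mul_of_quadratic {K : Type*} [Field K] {a c r s : K} (hrs : r ≠ s)
    (hr : a * r ^ 2 - c * r + 1 = 0) (hs : a * s ^ 2 - c * s + 1 = 0) :
    r + s = c * (r * s) :=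
  mul_left_cancel₀ (sub_ne_zero.2 hrs) (by linear_combination r ^ 2 * hs - s ^ 2 * hr)

/-- The relation `p r + q s = 1` and a reciprocal sum of `2 (p + q)` determine `r`,
apart from the degenerate case `r = s`. -/
theorem eq_one_div_two_mul_of_balance {K : Type*} [Field K] [CharZero K] {p q r s : K}
    (hp : p ≠ 0) (hq : q ≠ 0) (hrs : r ≠ s) (hsum : p * r + q * s = 1)
    (hadd : r + s = 2 * (p + q) * (r * s)) : r = 1 / (2 * p) := by
  have hfac : (1 - 2 * p * r) * (1 - (p + q) * r) = 0 := by
    linear_combination q * hadd + (2 * (p + q) * r - 1) * hsum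
  rcases mul_eq_zero.1 hfac with h | h
  · rw [eq_div_iff (mul_ne_zero two_ne_zero hp)]
    linear_combination -h
  · refine absurd (mul_left_cancel₀ hq ?_) hrs
    linear_combination -h - hsum

/-- Any genuinely two-valued positive solution of the quadratic system (Q10)
with `Σ b_i = 1`, taking the value `r` at exactly `p` indices and `s` at exactly `q`
indices (`p, q ≥ 1`), must have `p ≠ q` and `{r, s} = {1/(2p), 1/(2q)}`. -/
theorem clifford_torus_two_valued_solution (n : ℕ) (hn : 1 ≤ n)
    (b : Fin (n + 1) → ℝ) (hb : ∀ i, 0 < b i) (hsum : ∑ i, b i = 1)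
    (r s : ℝ) (hrs : r ≠ s) (p q : ℕ) (hp : 1 ≤ p) (hq : 1 ≤ q)
    (hpcard : {i | b i = r}.ncard = p) (hqcard : {i | b i = s}.ncard = q)
    (hval : ∀ i, b i = r ∨ b i = s)
    (heq : ∀ i, (2 * ((n : ℝ) + 1) ^ 2 - ∑ j, 1 / b j) * (b i) ^ 2 -
      2 * ((n : ℝ) + 1) * b i + 1 = 0) :
    p ≠ q ∧ ({r, s} : Set ℝ) = {1 / (2 * (p : ℝ)), 1 / (2 * (q : ℝ))} := by
  have hp0 : (p : ℝ) ≠ 0 := by positivity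
  have hq0 : (q : ℝ) ≠ 0 := by positivity
  have hcard : ((n : ℝ) + 1) = p + q := by
    simpa [hpcard, hqcard] using sum_comp_eq_of_two_valued hrs hval fun _ => (1 : ℝ)
  have hbal : p * r + q * s = 1 := by
    have h := sum_comp_eq_of_two_valued hrs hval id
    simp only [id, hsum, hpcard, hqcard, nsmul_eq_mul] at h
    exact h.symm
  obtain ⟨i, hi⟩ : {i | b i = r}.Nonempty := Set.nonempty_of_ncard_ne_zero (by omega)
  obtain ⟨j, hj⟩ : {i | b i = s}.Nonempty := Set.nonempty_of_ncard_ne_zero (by omega)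
  have hadd : r + s = 2 * (p + q : ℝ) * (r * s) := by
    rw [← hcard]
    exact add_eq_mul_mul_of_quadratic hrs (hi ▸ heq i) (hj ▸ heq j)
  have hr : r = 1 / (2 * (p : ℝ)) := eq_one_div_two_mul_of_balance hp0 hq0 hrs hbal hadd
  have hs : s = 1 / (2 * (q : ℝ)) :=
    eq_one_div_two_mul_of_balance hq0 hp0 hrs.symm (by linear_combination hbal)
      (by linear_combination hadd)
  refine ⟨?_, by rw [hr, hs]⟩
  rintro rfl
  exact hrs (hr.trans hs.symm)
end

section
/- Let p, q be positive natural numbers with p + q = n + 1, and let r, s be distinct positive reals with p·r + q·s = 1. Set d = p/r + q/s and t = 2(n+1)(n+3) − d. If t·r^2 − 2(n+3)·r + 1 = 0 and t·s^2 − 2(n+3)·s + 1 = 0, then t satisfies t^2 − (2(n+1)(n+3) − (p−q)^2)·t + 4pq(n+3)^2 = 0. -/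
/-- If the two distinct values `r, s` (with multiplicities `p, q`,
`p + q = n + 1`, `p·r + q·s = 1`) both solve `t·x^2 − 2(n+3)·x + 1 = 0` with
`t = 2(n+1)(n+3) − d`, `d = p/r + q/s`, then `t` satisfies the eliminant quadratic (E11):
`t^2 − (2(n+1)(n+3) − (p−q)^2)·t + 4pq(n+3)^2 = 0`. -/
theorem lagrangian_clifford_eliminant (p q n : ℕ) (hp : 0 < p) (hq : 0 < q)
    (hpq : p + q = n + 1) (r s : ℝ) (hr : 0 < r) (hs : 0 < s) (hrs : r ≠ s)
    (hsum : (p : ℝ) * r + (q : ℝ) * s = 1) (d t : ℝ)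
    (hd : d = (p : ℝ) / r + (q : ℝ) / s)
    (ht : t = 2 * ((n : ℝ) + 1) * ((n : ℝ) + 3) - d)
    (h1 : t * r ^ 2 - 2 * ((n : ℝ) + 3) * r + 1 = 0)
    (h2 : t * s ^ 2 - 2 * ((n : ℝ) + 3) * s + 1 = 0) :
    t ^ 2 - (2 * ((n : ℝ) + 1) * ((n : ℝ) + 3) - ((p : ℝ) - (q : ℝ)) ^ 2) * t +
      4 * (p : ℝ) * (q : ℝ) * ((n : ℝ) + 3) ^ 2 = 0 := by
  have hn : (n : ℝ) = p + q - 1 := by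
    have : (p : ℝ) + q = n + 1 := mod_cast hpq
    linarith
  have vieta : t * (r + s) = 2 * ((n : ℝ) + 3) :=
    mul_right_cancel₀ (sub_ne_zero.mpr hrs) (by linear_combination h1 - h2)
  have lin : t = p * (t * r) + q * (2 * ((n : ℝ) + 3) - t * r) := by
    linear_combination -t * hsum + q * vieta
  rw [hn] at h1 lin ⊢
  linear_combination ((p : ℝ) - q) ^ 2 * t * h1 +
    (t - (p + q) * (p + q + 2) + (p - q) * (t * r - (p + q + 2))) * lin
end

section
/- Let p, q be positive natural numbers with p ≠ q and p + q = n + 1. Then there exist distinct positive reals r and s with p·r + q·s = 1 such that, setting d = p/r + q/s and t = 2(n+1)(n+3) − d, both r and s satisfy t·x^2 − 2(n+3)·x + 1 = 0. Consequently the tuple b : Fin (n+1) → ℝ taking the value r at p indices and s at q indices is a positive, non-constant solution of the quadratic system (Q3) with Σ b_i = 1. -/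
/-- The sum of `f ∘ b` for a two-valued tuple `b` is determined by the multiplicities. -/
theorem sum_comp_of_two_valued {ι : Type*} [Fintype ι] {α : Type*} {r s : α} (hrs : r ≠ s)
    {b : ι → α} (hb : ∀ i, b i = r ∨ b i = s) (f : α → ℝ) :
    ∑ i, f (b i) = ({i | b i = r}.ncard : ℝ) * f r + ({i | b i = s}.ncard : ℝ) * f s := by
  classical
  have hfilter : Finset.univ.filter (fun i => ¬ b i = r) = Finset.univ.filter (fun i => b i = s) :=
    Finset.filter_congr fun i _ =>
      ⟨fun h => (hb i).resolve_left h, fun h h' => hrs (h'.symm.trans h)⟩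
  have hconst (c : α) :
      ∑ i ∈ Finset.univ.filter (fun i => b i = c), f (b i) = ({i | b i = c}.ncard : ℝ) * f c := by
    rw [Finset.sum_congr rfl (g := fun _ => f c) (by simp +contextual), Finset.sum_const,
      nsmul_eq_mul, Set.ncard_eq_toFinset_card']
    simp
  rw [← Finset.sum_filter_add_sum_filter_not Finset.univ (fun i => b i = r), hfilter,
    hconst, hconst]

/-- The two radii exist: they are cut out by `p r + q s = 1` and `r + s = 2 (p + q + 2) r s`. -/
theorem exists_clifford_radii {p q : ℝ} (hp : 0 < p) (hq : 0 < q) :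
    ∃ r s : ℝ, 0 < r ∧ 0 < s ∧ r ≠ s ∧ p * r + q * s = 1 ∧
      r + s = 2 * (p + q + 2) * r * s := by
  have hD : 0 ≤ 8 * (p + q + 2) + (p - q) ^ 2 := by positivity
  set w := √(8 * (p + q + 2) + (p - q) ^ 2)
  have hw2 : w ^ 2 = 8 * (p + q + 2) + (p - q) ^ 2 := Real.sq_sqrt hD
  have hw0 : 0 ≤ w := Real.sqrt_nonneg _
  have hlt : w < p + 3 * q + 4 := by
    refine lt_of_pow_lt_pow_left₀ 2 (by linarith) ?_
    nlinarith [mul_pos hp hq]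
  have hM : 0 < p + q + 2 := by positivity
  have hr : 0 < (3 * p + q + 4 + w) / (4 * (p + q + 2) * p) := by positivity
  have hs : 0 < (p + 3 * q + 4 - w) / (4 * (p + q + 2) * q) :=
    div_pos (by linarith) (by positivity)
  have hsum : p * ((3 * p + q + 4 + w) / (4 * (p + q + 2) * p)) +
      q * ((p + 3 * q + 4 - w) / (4 * (p + q + 2) * q)) = 1 := by
    field_simp
    ring
  have hprod : (3 * p + q + 4 + w) / (4 * (p + q + 2) * p) +
      (p + 3 * q + 4 - w) / (4 * (p + q + 2) * q) =
      2 * (p + q + 2) * ((3 * p + q + 4 + w) / (4 * (p + q + 2) * p)) *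
        ((p + 3 * q + 4 - w) / (4 * (p + q + 2) * q)) := by
    field_simp
    linear_combination 2 * hw2
  refine ⟨_, _, hr, hs, fun h => ?_, hsum, hprod⟩
  rw [← h] at hsum hprod
  generalize (3 * p + q + 4 + w) / (4 * (p + q + 2) * p) = x at *
  nlinarith

/-- If `r + s = 2 m r s` and `p r + q s = 1`, then `r` is a root of the quadratic with leading
coefficient `2 (p + q) m - (p / r + q / s)`. -/
theorem clifford_quadratic_eq_zero {p q m r s : ℝ} (hr : r ≠ 0) (hs : s ≠ 0)
    (hsum : p * r + q * s = 1) (hprod : r + s = 2 * m * r * s) :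
    (2 * (p + q) * m - (p / r + q / s)) * r ^ 2 - 2 * m * r + 1 = 0 := by
  have hlead : 2 * (p + q) * m - (p / r + q / s) = 1 / (r * s) := by
    field_simp
    linear_combination hsum - (p + q) * hprod
  rw [hlead]
  field_simp
  linear_combination hprod


/-- For `p ≠ q` with `p, q ≥ 1`, `p + q = n + 1`, there exist distinct
positive reals `r, s` with `p·r + q·s = 1` such that, with `d = p/r + q/s` and
`t = 2(n+1)(n+3) − d`, both `r` and `s` solve `t·x^2 − 2(n+3)·x + 1 = 0`; consequently
any tuple `b : Fin (n+1) → ℝ` taking the value `r` at `p` indices and `s` at `q` indices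
is a positive, non-constant solution of the quadratic system (Q3) with `Σ b_i = 1`. -/
theorem lagrangian_clifford_exists_solution (p q n : ℕ) (hp : 0 < p) (hq : 0 < q)
    (hne : p ≠ q) (hpq : p + q = n + 1) :
    ∃ r s : ℝ, 0 < r ∧ 0 < s ∧ r ≠ s ∧ (p : ℝ) * r + (q : ℝ) * s = 1 ∧
      ((2 * ((n : ℝ) + 1) * ((n : ℝ) + 3) - ((p : ℝ) / r + (q : ℝ) / s)) * r ^ 2 -
          2 * ((n : ℝ) + 3) * r + 1 = 0) ∧
      ((2 * ((n : ℝ) + 1) * ((n : ℝ) + 3) - ((p : ℝ) / r + (q : ℝ) / s)) * s ^ 2 -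
          2 * ((n : ℝ) + 3) * s + 1 = 0) ∧
      ∀ b : Fin (n + 1) → ℝ,
        {i | b i = r}.ncard = p → {i | b i = s}.ncard = q →
        (∀ i, b i = r ∨ b i = s) →
        (∀ i, 0 < b i) ∧ (¬ ∀ i j, b i = b j) ∧ (∑ i, b i = 1) ∧
        (∀ i, (2 * ((n : ℝ) + 1) * ((n : ℝ) + 3) - ∑ j, 1 / b j) * (b i) ^ 2 -
          2 * ((n : ℝ) + 3) * b i + 1 = 0) := by
  have hp' : (0 : ℝ) < p := by exact_mod_cast hp
  have hq' : (0 : ℝ) < q := by exact_mod_cast hq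
  have hn : (n : ℝ) + 1 = p + q := by exact_mod_cast hpq.symm
  have hm : (n : ℝ) + 3 = p + q + 2 := by linarith
  obtain ⟨r, s, hr, hs, hrs, hsum, hprod⟩ := exists_clifford_radii hp' hq'
  rw [hn, hm]
  have hR := clifford_quadratic_eq_zero hr.ne' hs.ne' hsum hprod
  have hS := clifford_quadratic_eq_zero (p := q) (q := p) (m := p + q + 2) hs.ne' hr.ne'
    (by linarith) (by linarith)
  rw [add_comm (q : ℝ) p, add_comm ((q : ℝ) / s)] at hS
  refine ⟨r, s, hr, hs, hrs, hsum, hR, hS, fun b hbr hbs hb => ⟨fun i => ?_, fun h => ?_, ?_, ?_⟩⟩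
  · rcases hb i with h | h <;> rwa [h]
  · obtain ⟨i, hi⟩ := Set.nonempty_of_ncard_ne_zero (hbr.trans_ne hp.ne')
    obtain ⟨j, hj⟩ := Set.nonempty_of_ncard_ne_zero (hbs.trans_ne hq.ne')
    exact hrs (hi.symm.trans ((h i j).trans hj))
  · rw [← hsum, sum_comp_of_two_valued hrs hb fun x => x, hbr, hbs]
  · intro i
    rw [sum_comp_of_two_valued hrs hb fun x => 1 / x, hbr, hbs, mul_one_div, mul_one_div]
    rcases hb i with h | h <;> rwa [h]
end
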